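/- Let β > 0 and define J : (0,∞)² → ℝ by J(a, p) = (1/(6π))·((4a − 7p)·√(a − p) + 3·(a − 2p)·√p · arcsin √(p/a)) if a > p and J(a, p) = (1/4)·(a − 2p)·√p if a ≤ p. Then ∫₀^∞ ∫₀^∞ (β^{3/2}/√(π·p))·e^{−β(a + p)}·(a − p)·J(a, p) da dp = 2/(β²·√(2πβ)). -/

import Mathlib

open MeasureTheory Real

noncomputable def hh16 (t : ℝ) : ℝ :=
  (t - 1) * (if 1 < t then
    (1/(6*Real.pi)) * ((4*t - 7) * Real.sqrt (t - 1)
      + 3 * (t - 2) * Real.arcsin (Real.sqrt (1/t)))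
    else (1/4) * (t - 2))

lemma hh16_meas : Measurable hh16 := by
  unfold hh16
  refine Measurable.mul (by fun_prop) (Measurable.ite measurableSet_Ioi ?_ (by fun_prop))
  have : Measurable Real.arcsin := Real.continuous_arcsin.measurable
  fun_prop

lemma hh16_bound (t : ℝ) (ht : 0 < t) : |hh16 t| ≤ 100 * (1 + t) ^ 2 * Real.sqrt (1 + t) := by
  have hs1 : 1 ≤ Real.sqrt (1 + t) := by
    rw [Real.one_le_sqrt]; linarith
  have hs : Real.sqrt (t - 1) ≤ Real.sqrt (1 + t) := Real.sqrt_le_sqrt (by linarith)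
  have hs0 := Real.sqrt_nonneg (t - 1)
  have ha : |Real.arcsin (Real.sqrt (1/t))| ≤ 2 := by
    rw [abs_le]
    have h1 := Real.neg_pi_div_two_le_arcsin (Real.sqrt (1/t))
    have h2 := Real.arcsin_le_pi_div_two (Real.sqrt (1/t))
    have := Real.pi_le_four
    constructor <;> linarith
  have hpi : |1 / (6 * Real.pi)| ≤ 1 := by
    rw [abs_of_pos (by positivity), div_le_one (by positivity)]
    linarith [Real.pi_gt_three]
  have h1 : |t - 1| ≤ 1 + t := by rw [abs_le]; constructor <;> linarith
  have h47 : |4 * t - 7| ≤ 7 * (1 + t) := by rw [abs_le]; constructor <;> linarith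
  have h2 : |t - 2| ≤ 2 * (1 + t) := by rw [abs_le]; constructor <;> linarith
  unfold hh16
  rw [abs_mul]
  have key : |(if 1 < t then
    (1/(6*Real.pi)) * ((4*t - 7) * Real.sqrt (t - 1)
      + 3 * (t - 2) * Real.arcsin (Real.sqrt (1/t)))
    else (1/4) * (t - 2))| ≤ 100 * (1 + t) * Real.sqrt (1 + t) := by
    have hp : 0 < (1 + t) := by linarith
    have hq : (1 + t) ≤ (1 + t) * Real.sqrt (1 + t) := by nlinarith
    split_ifs
    · rw [abs_mul]
      calc _ ≤ 1 * (7 * (1 + t) * Real.sqrt (1 + t) + 3 * (2 * (1 + t)) * 2) := by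
            gcongr
            refine (abs_add_le _ _).trans ?_
            rw [abs_mul, abs_mul, abs_mul, abs_of_nonneg hs0, abs_of_pos (by norm_num : (0:ℝ) < 3)]
            gcongr
        _ ≤ _ := by nlinarith
    · rw [abs_mul, abs_of_pos (by norm_num : (0:ℝ) < 1/4)]
      nlinarith
  calc _ ≤ (1 + t) * (100 * (1 + t) * Real.sqrt (1 + t)) := by gcongr
    _ = _ := by ring

lemma hh16_int : IntegrableOn (fun t => hh16 t / (1 + t) ^ 4) (Set.Ioi 0) := by
  have h0 : IntegrableOn (fun t : ℝ => 100 * (t + 1) ^ (-(3:ℝ)/2)) (Set.Ioi 0) :=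
    (integrableOn_add_rpow_Ioi_of_lt (by norm_num) (by norm_num)).const_mul 100
  refine Integrable.mono' h0 ?_ ?_
  · exact (hh16_meas.div (by fun_prop)).aestronglyMeasurable
  · filter_upwards [ae_restrict_mem measurableSet_Ioi] with t ht
    have ht : 0 < t := ht
    have hp : 0 < 1 + t := by linarith
    rw [Real.norm_eq_abs, abs_div, abs_of_pos (by positivity : 0 < (1 + t) ^ 4),
      div_le_iff₀ (by positivity)]
    refine (hh16_bound t ht).trans (le_of_eq ?_)
    rw [add_comm t 1, Real.sqrt_eq_rpow]
    rw [mul_assoc, mul_assoc, ← Real.rpow_natCast, ← Real.rpow_natCast, ← Real.rpow_add hp,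
      ← Real.rpow_add hp]
    norm_num

lemma arcsin16 (t : ℝ) (ht : 1 < t) :
    Real.arcsin (Real.sqrt (1/t)) = Real.pi/2 - Real.arctan (Real.sqrt (t-1)) := by
  apply Real.arcsin_eq_of_sin_eq
  · rw [Real.sin_pi_div_two_sub, Real.cos_arctan, Real.sq_sqrt (by linarith),
      Real.sqrt_div (by norm_num)]
    simp
  · have := Real.arctan_lt_pi_div_two (Real.sqrt (t-1))
    have h := Real.arctan_nonneg.2 (Real.sqrt_nonneg (t-1))
    constructor <;> linarith [Real.pi_pos]

noncomputable def GG16 (u : ℝ) : ℝ :=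
  3 * ((1 + u^2) * ((u^2+2)^2 - (u^2+2) + 4) / (2 * (u^2+2)^3)) * (Real.pi/2 - Real.arctan u)
  + u * (-22/3/(u^2+2)^3 + 67/6/(u^2+2)^2 - 11/2/(u^2+2))
  + 2 * Real.sqrt 2 * Real.arctan (u / Real.sqrt 2)

lemma GG16_deriv (u : ℝ) : HasDerivAt GG16
    (2 * u * (u^2 / (u^2+2)^4 * ((4*u^2-3) * u + 3 * (u^2-1) * (Real.pi/2 - Real.arctan u)))) u := by
  have hs : HasDerivAt (fun u : ℝ => u^2) (2*u) u := by simpa using hasDerivAt_pow 2 u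
  have hs2 : HasDerivAt (fun u : ℝ => u^2+2) (2*u) u := hs.add_const 2
  have hne : u^2+2 ≠ 0 := by positivity
  have hne1 : 1 + u^2 ≠ 0 := by positivity
  have h2 : Real.sqrt 2 ^ 2 = 2 := Real.sq_sqrt (by norm_num)
  have h2' : Real.sqrt 2 ≠ 0 := by positivity
  have hA := (((hs.const_add 1).mul (((hs2.pow 2).sub hs2).add_const 4)).div
    ((hs2.pow 3).const_mul 2) (by simp; positivity)).const_mul 3
  have hB := hA.mul ((Real.hasDerivAt_arctan u).const_sub (Real.pi/2))
  have hC := (hasDerivAt_id u).mul ((((hasDerivAt_const u (-22/3:ℝ)).div (hs2.pow 3)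
    (by simp; positivity)).add ((hasDerivAt_const u (67/6:ℝ)).div (hs2.pow 2)
    (by simp; positivity))).sub ((hasDerivAt_const u (11/2:ℝ)).div hs2 hne))
  have hD := (((hasDerivAt_id u).div_const (Real.sqrt 2)).arctan).const_mul (2 * Real.sqrt 2)
  have hE : HasDerivAt GG16 _ u := (hB.add hC).add hD
  refine hE.congr_deriv ?_
  symm
  simp only [id, Pi.pow_apply, Pi.mul_apply, Pi.add_apply, Pi.sub_apply, Pi.div_apply]
  have e : 2 * Real.sqrt 2 * (1 / (1 + (u / Real.sqrt 2)^2) * (1 / Real.sqrt 2)) = 4 / (u^2+2) := by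
    rw [div_pow, h2]; field_simp; ring
  rw [e]
  generalize Real.pi/2 - Real.arctan u = A
  field_simp
  ring

lemma GG16_lim : Filter.Tendsto GG16 Filter.atTop (nhds (Real.sqrt 2 * Real.pi)) := by
  have hw : Filter.Tendsto (fun u : ℝ => (u^2+2)⁻¹) Filter.atTop (nhds 0) :=
    tendsto_inv_atTop_zero.comp (Filter.tendsto_atTop_add_const_right _ 2
      (Filter.tendsto_pow_atTop (by norm_num)))
  have huw : Filter.Tendsto (fun u : ℝ => u * (u^2+2)⁻¹) Filter.atTop (nhds 0) := by
    have h := (tendsto_inv_atTop_zero (𝕜 := ℝ)).mul ((hw.const_mul 2).const_sub 1)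
    rw [zero_mul] at h
    refine h.congr' ?_
    filter_upwards [Filter.eventually_gt_atTop 0] with u hu
    field_simp
    ring
  have hat : Filter.Tendsto Real.arctan Filter.atTop (nhds (Real.pi/2)) :=
    Real.tendsto_arctan_atTop.mono_right nhdsWithin_le_nhds
  have hat2 : Filter.Tendsto (fun u => Real.arctan (u / Real.sqrt 2)) Filter.atTop
      (nhds (Real.pi/2)) :=
    hat.comp (Filter.tendsto_id.atTop_div_const (by positivity))
  have h := ((((hw.const_sub 1).mul ((hw.const_sub 1).add ((hw.pow 2).const_mul 4))).const_mul
    (3/2)).mul (hat.const_sub (Real.pi/2))).add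
    (huw.mul ((((hw.pow 2).const_mul (-22/3)).add (hw.const_mul (67/6))).sub_const (11/2)))
  have h' := h.add (hat2.const_mul (2 * Real.sqrt 2))
  have e : ∀ x y : ℝ, x = y → nhds x = nhds y := fun x y h => by rw [h]
  rw [e _ _ (show _ = Real.sqrt 2 * Real.pi by ring)] at h'
  refine h'.congr (fun u => ?_)
  unfold GG16
  have hne : u^2+2 ≠ 0 := by positivity
  congr 1
  congr 1
  · congr 1
    field_simp
    ring
  · field_simp

lemma int16_hi : ∫ t in Set.Ioi (1:ℝ), hh16 t / (1 + t) ^ 4 =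
    1/(6*Real.pi) * (Real.sqrt 2 * Real.pi - 9 * Real.pi / 16) := by
  have hlim : Filter.Tendsto (fun t => 1/(6*Real.pi) * GG16 (Real.sqrt (t-1))) Filter.atTop
      (nhds (1/(6*Real.pi) * (Real.sqrt 2 * Real.pi))) := by
    refine (GG16_lim.comp ?_).const_mul _
    exact Real.tendsto_sqrt_atTop.comp (Filter.tendsto_atTop_add_const_right _ (-1) Filter.tendsto_id)
  have hcont : Continuous GG16 := continuous_iff_continuousAt.2 fun u => (GG16_deriv u).continuousAt
  have := integral_Ioi_of_hasDerivAt_of_tendsto (a := (1:ℝ))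
    (f := fun t => 1/(6*Real.pi) * GG16 (Real.sqrt (t-1)))
    (f' := fun t => hh16 t / (1 + t) ^ 4) (m := 1/(6*Real.pi) * (Real.sqrt 2 * Real.pi))
    (by apply Continuous.continuousWithinAt; fun_prop) ?_
    (hh16_int.mono_set (Set.Ioi_subset_Ioi (by norm_num))) hlim
  · rw [this]
    simp [GG16]
    ring
  · intro t ht
    have ht : 1 < t := ht
    have hp : 0 < t - 1 := by linarith
    have h1 := ((hasDerivAt_id t).sub_const 1).sqrt hp.ne'
    have h2 : HasDerivAt (fun t => 1/(6*Real.pi) * GG16 (Real.sqrt (t-1))) _ t :=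
      ((GG16_deriv (Real.sqrt (t-1))).comp t h1).const_mul (1/(6*Real.pi))
    refine h2.congr_deriv ?_
    symm
    have hsq : Real.sqrt (t-1) ^ 2 = t - 1 := Real.sq_sqrt hp.le
    have hne : Real.sqrt (t-1) ≠ 0 := by positivity
    unfold hh16
    rw [if_pos ht, arcsin16 t ht, hsq]
    simp only [id]
    have e1 : 1 + t ≠ 0 := by positivity
    have e2 : t - 1 + 2 ≠ 0 := by linarith
    rw [show 1 + t = t - 1 + 2 by ring]
    generalize Real.arctan √(t-1) = A
    field_simp
    ring

lemma int16_lo : ∫ t in Set.Ioc (0:ℝ) 1, hh16 t / (1 + t) ^ 4 = 3/32 := by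
  have h : ∫ t in (0:ℝ)..1, hh16 t / (1 + t) ^ 4 =
      (fun t : ℝ => 1/4 * ((-2*(1+t)^2 + 5*(1+t) - 4)/(2*(1+t)^3))) 1 -
      (fun t : ℝ => 1/4 * ((-2*(1+t)^2 + 5*(1+t) - 4)/(2*(1+t)^3))) 0 := by
    refine intervalIntegral.integral_eq_sub_of_hasDerivAt
      (f := fun t : ℝ => 1/4 * ((-2*(1+t)^2 + 5*(1+t) - 4)/(2*(1+t)^3))) ?_ ?_
    · intro t ht
      rw [Set.uIcc_of_le (by norm_num)] at ht
      obtain ⟨h0, h1⟩ := ht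
      have hne : 1 + t ≠ 0 := by positivity
      have hs := (hasDerivAt_id t).const_add 1
      have hA : HasDerivAt (fun t : ℝ => 1/4 * ((-2*(1+t)^2 + 5*(1+t) - 4)/(2*(1+t)^3))) _ t :=
        (((((hs.pow 2).const_mul (-2)).add (hs.const_mul 5)).sub_const 4).div
          ((hs.pow 3).const_mul 2) (by simp; positivity)).const_mul (1/4)
      refine hA.congr_deriv ?_
      unfold hh16
      rw [if_neg (by linarith)]
      simp only [id, Pi.pow_apply, Pi.mul_apply, Pi.add_apply, Pi.sub_apply, Pi.div_apply]
      field_simp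
      ring
    · rw [intervalIntegrable_iff_integrableOn_Ioc_of_le (by norm_num)]
      exact hh16_int.mono_set Set.Ioc_subset_Ioi_self
  rw [← intervalIntegral.integral_of_le (by norm_num), h]
  norm_num

lemma int16 : ∫ t in Set.Ioi (0:ℝ), hh16 t / (1 + t) ^ 4 = Real.sqrt 2 / 6 := by
  rw [← Set.Ioc_union_Ioi_eq_Ioi (zero_le_one' ℝ), setIntegral_union (Set.Ioc_disjoint_Ioi le_rfl)
    measurableSet_Ioi (hh16_int.mono_set Set.Ioc_subset_Ioi_self)
    (hh16_int.mono_set (Set.Ioi_subset_Ioi (by norm_num))), int16_lo, int16_hi]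
  field_simp
  ring

lemma gam16 (c : ℝ) (hc : 0 < c) : IntegrableOn (fun p : ℝ => p^3 * Real.exp (-c*p)) (Set.Ioi 0) ∧
    ∫ p in Set.Ioi (0:ℝ), p^3 * Real.exp (-c*p) = 6 / c^4 := by
  constructor
  · have := integrableOn_rpow_mul_exp_neg_mul_rpow (p := 1) (s := 3) (b := c) (by norm_num) (by norm_num) hc
    refine this.congr_fun (fun p hp => ?_) measurableSet_Ioi
    simp only [Real.rpow_one]
    norm_cast
  · have := Real.integral_rpow_mul_exp_neg_mul_Ioi (a := 4) (r := c) (by norm_num) hc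
    have h4 : Real.Gamma 4 = 6 := by
      have := Real.Gamma_nat_eq_factorial 3
      rw [show ((3:ℕ):ℝ) + 1 = 4 by norm_num] at this
      rw [this]; norm_num [Nat.factorial]
    rw [h4] at this
    rw [show (6:ℝ) / c^4 = (1/c)^(4:ℝ) * 6 by
      rw [show (4:ℝ) = ((4:ℕ):ℝ) by norm_num, Real.rpow_natCast]; field_simp, ← this]
    refine setIntegral_congr_fun measurableSet_Ioi (fun p hp => ?_)
    norm_num

lemma fub16 (β : ℝ) (hβ : 0 < β) :
    ∫ p in Set.Ioi (0:ℝ), ∫ t in Set.Ioi (0:ℝ), p^3 * Real.exp (-(β*(1+t))*p) * hh16 t =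
      6 / β^4 * (Real.sqrt 2 / 6) := by
  have heq : ∀ t ∈ Set.Ioi (0:ℝ), ∫ p in Set.Ioi (0:ℝ), p^3 * Real.exp (-(β*(1+t))*p) * hh16 t =
      6 / β^4 * (hh16 t / (1 + t)^4) := by
    intro t ht
    have ht : 0 < t := ht
    rw [integral_mul_const, (gam16 (β*(1+t)) (by positivity)).2]
    field_simp
  rw [integral_integral_swap]
  · rw [setIntegral_congr_fun measurableSet_Ioi heq, integral_const_mul, int16]
  · rw [integrable_prod_iff']
    · constructor
      · filter_upwards [ae_restrict_mem measurableSet_Ioi] with t ht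
        have ht : 0 < t := ht
        exact (gam16 (β*(1+t)) (by positivity)).1.mul_const (hh16 t)
      · have h1 := (hh16_int.norm).const_mul (6 / β^4)
        refine h1.congr ?_
        filter_upwards [ae_restrict_mem measurableSet_Ioi] with t ht
        have ht : 0 < t := ht
        have e : ∫ p in Set.Ioi (0:ℝ), ‖p^3 * Real.exp (-(β*(1+t))*p) * hh16 t‖ =
            ∫ p in Set.Ioi (0:ℝ), p^3 * Real.exp (-(β*(1+t))*p) * |hh16 t| := by
          refine setIntegral_congr_fun measurableSet_Ioi (fun p hp => ?_)
          have hp : 0 < p := hp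
          simp only [norm_mul, Real.norm_eq_abs]
          rw [abs_of_pos (Real.exp_pos _), abs_of_pos (by positivity)]
        simp only [Function.uncurry]
        rw [e, integral_mul_const, (gam16 (β*(1+t)) (by positivity)).2, norm_div, Real.norm_eq_abs,
          Real.norm_eq_abs, abs_of_pos (by positivity : 0 < (1+t)^4)]
        field_simp
    · have := hh16_meas
      apply Measurable.aestronglyMeasurable
      simp only [Function.uncurry_def]
      fun_prop

lemma inner16 (β : ℝ) (p : ℝ) (hp : 0 < p) :
    ∫ a in Set.Ioi (0:ℝ),
        (β ^ ((3:ℝ)/2) / Real.sqrt (Real.pi * p)) * Real.exp (-β*(a + p)) *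
          ((a - p) *
            (if p < a then
                (1/(6*Real.pi)) * ((4*a - 7*p) * Real.sqrt (a - p)
                  + 3 * (a - 2*p) * Real.sqrt p * Real.arcsin (Real.sqrt (p/a)))
              else (1/4) * (a - 2*p) * Real.sqrt p)) =
    (β ^ ((3:ℝ)/2) / Real.sqrt Real.pi) *
      ∫ t in Set.Ioi (0:ℝ), p^3 * Real.exp (-(β*(1+t))*p) * hh16 t := by
  have h := integral_comp_mul_left_Ioi (fun a => (β ^ ((3:ℝ)/2) / Real.sqrt (Real.pi * p)) * Real.exp (-β*(a + p)) *
          ((a - p) *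
            (if p < a then
                (1/(6*Real.pi)) * ((4*a - 7*p) * Real.sqrt (a - p)
                  + 3 * (a - 2*p) * Real.sqrt p * Real.arcsin (Real.sqrt (p/a)))
              else (1/4) * (a - 2*p) * Real.sqrt p))) 0 hp
  rw [mul_zero, smul_eq_mul, eq_inv_mul_iff_mul_eq₀ hp.ne', ← integral_const_mul] at h
  rw [← h, ← integral_const_mul]
  refine setIntegral_congr_fun measurableSet_Ioi (fun t ht => ?_)
  have ht : 0 < t := ht
  have c : p < p * t ↔ 1 < t := by
    constructor
    · intro h; by_contra h'; push Not at h'; nlinarith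
    · intro h; nlinarith
  have hsp : Real.sqrt p ≠ 0 := by positivity
  have hspi : Real.sqrt Real.pi ≠ 0 := by positivity
  simp only [c, hh16]
  rw [show p / (p * t) = 1 / t by field_simp, show p * t - p = p * (t - 1) by ring,
    Real.sqrt_mul hp.le, Real.sqrt_mul Real.pi_pos.le,
    show -β * (p * t + p) = -(β*(1+t))*p by ring]
  split_ifs
  · field_simp
  · field_simp

theorem stmt_16 (β : ℝ) (hβ : 0 < β) :
    ∫ p in Set.Ioi (0:ℝ), ∫ a in Set.Ioi (0:ℝ),
        (β ^ ((3:ℝ)/2) / Real.sqrt (Real.pi * p)) * Real.exp (-β*(a + p)) *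
          ((a - p) *
            (if p < a then
                (1/(6*Real.pi)) * ((4*a - 7*p) * Real.sqrt (a - p)
                  + 3 * (a - 2*p) * Real.sqrt p * Real.arcsin (Real.sqrt (p/a)))
              else (1/4) * (a - 2*p) * Real.sqrt p)) =
      2/(β^2 * Real.sqrt (2*Real.pi*β)) := by
  rw [setIntegral_congr_fun measurableSet_Ioi (fun p hp => inner16 β p hp), integral_const_mul,
    fub16 β hβ]
  have e : β ^ ((3:ℝ)/2) = β * Real.sqrt β := by
    rw [Real.sqrt_eq_rpow, ← Real.rpow_one_add' hβ.le (by norm_num)]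
    norm_num
  have h2 : Real.sqrt 2 ^ 2 = 2 := Real.sq_sqrt (by norm_num)
  have h3 : Real.sqrt β ^ 2 = β := Real.sq_sqrt hβ.le
  rw [e, Real.sqrt_mul (by positivity), Real.sqrt_mul (by norm_num)]
  have : Real.sqrt β ≠ 0 := by positivity
  have : Real.sqrt Real.pi ≠ 0 := by positivity
  field_simp
  rw [h2, h3]
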